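/- Let p and q be primes with p ≥ 3 and q ≥ 3. If the left commutation semigroups Λ(D_p) and Λ(D_q) are isomorphic as semigroups, then p = q. (In fact the weaker hypothesis |Λ(D_p)| = |Λ(D_q)| already forces p = q.) -/

import Mathlib

open DihedralGroup

/-- The commutator `[g,h] = g⁻¹ h⁻¹ g h`. -/
def gcomm {G : Type*} [Group G] (g h : G) : G := g⁻¹ * h⁻¹ * g * h

/-- The right commutation map `ρ(g) : x ↦ [x,g]`. -/
def rmap {G : Type*} [Group G] (g : G) : G → G := fun x => gcomm x g

/-- The left commutation map `λ(g) : x ↦ [g,x]`. -/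
def lmap {G : Type*} [Group G] (g : G) : G → G := fun x => gcomm g x

/-- The element `a^i b^j` of the dihedral group `D_m`, where `a = r 1`, `b = sr 0`. -/
def elt (m : ℕ) (i : ZMod m) (j : ZMod 2) : DihedralGroup m :=
  r i * (sr 0 : DihedralGroup m) ^ j.val

/-- The map `μ(A,B)`, sending `a^i b^j` to `a^(A·i·(-1)^j − B·((-1)^j − 1))`.
Note `sr k = a^(-k) b`, so `μ(A,B)` sends `sr k` to `r (A·k + 2·B)`. -/
def mumap (m : ℕ) (A B : ZMod m) : DihedralGroup m → DihedralGroup m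
  | .r i => .r (A * i)
  | .sr k => .r (A * k + 2 * B)

/-- The `(A,B)`-container `C(A,B) = { μ(A, x·B) : x ∈ ℤ_m }`. -/
def cont (m : ℕ) (A B : ZMod m) : Set (DihedralGroup m → DihedralGroup m) :=
  { f | ∃ x : ZMod m, f = mumap m A (x * B) }

/-- The left commutation semigroup `Λ(D_m)`. -/
def Lsg (m : ℕ) : Subsemigroup (Function.End (DihedralGroup m)) :=
  Subsemigroup.closure {f : Function.End (DihedralGroup m) | ∃ g : DihedralGroup m, f = lmap g}

/-- `λ(a^i) = μ(0, -i)`. -/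
theorem lmap_r (m : ℕ) (i : ZMod m) : lmap (r i : DihedralGroup m) = mumap m 0 (-i) := by
  funext x
  rcases x with j | k
  · simp [lmap, gcomm, mumap]
  · simp [lmap, gcomm, mumap]
    ring

/-- `λ(sr i) = μ(2, -i)`. -/
theorem lmap_sr (m : ℕ) (i : ZMod m) : lmap (sr i : DihedralGroup m) = mumap m 2 (-i) := by
  funext x
  rcases x with j | k
  · simp [lmap, gcomm, mumap]
    ring
  · simp [lmap, gcomm, mumap]
    ring

theorem mumap_comp (m : ℕ) (A B C D : ZMod m) :
    mumap m A B ∘ mumap m C D = mumap m (A * C) (A * D) := by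
  funext x
  rcases x with j | k
  · simp [mumap, mul_assoc]
  · simp [mumap]
    ring

/-- For odd `m`, the map `μ(A,B)` determines `A` and `B`. -/
theorem mumap_injective {m : ℕ} (hm : Odd m) :
    Function.Injective fun x : ZMod m × ZMod m => mumap m x.1 x.2 := by
  rintro ⟨A, B⟩ ⟨C, D⟩ h
  have hA : A = C := by simpa [mumap] using congrFun h (r 1)
  have hB : (2 : ZMod m) * B = 2 * D := by simpa [mumap] using congrFun h (sr 0)
  have h2 : IsUnit (2 : ZMod m) := by
    simpa using (ZMod.isUnit_iff_coprime 2 m).2 (Nat.coprime_two_left.2 hm)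
  exact Prod.ext hA (h2.mul_left_cancel hB)

/-- The possible first parameters of the maps `μ(A,B)` lying in `Λ(D_m)`: zero and the
positive powers of two. -/
def multipliers (m : ℕ) : Set (ZMod m) := {A | A = 0 ∨ ∃ n : ℕ, A = 2 ^ (n + 1)}

theorem mul_mem_multipliers {m : ℕ} {A C : ZMod m} (hA : A ∈ multipliers m)
    (hC : C ∈ multipliers m) : A * C ∈ multipliers m := by
  rcases hA with rfl | ⟨a, rfl⟩
  · exact Or.inl (zero_mul C)
  · rcases hC with rfl | ⟨c, rfl⟩
    · exact Or.inl (mul_zero _)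
    · exact Or.inr ⟨a + c + 1, by ring⟩

theorem mumap_zero_mem (m : ℕ) (B : ZMod m) :
    (mumap m 0 B : Function.End (DihedralGroup m)) ∈ Lsg m :=
  Subsemigroup.subset_closure ⟨r (-B), by rw [lmap_r, neg_neg]⟩

theorem mumap_two_mem (m : ℕ) (B : ZMod m) :
    (mumap m 2 B : Function.End (DihedralGroup m)) ∈ Lsg m :=
  Subsemigroup.subset_closure ⟨sr (-B), by rw [lmap_sr, neg_neg]⟩

theorem mumap_two_pow_mem {m : ℕ} (hm : Odd m) (n : ℕ) (B : ZMod m) :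
    (mumap m (2 ^ (n + 1)) B : Function.End (DihedralGroup m)) ∈ Lsg m := by
  induction n generalizing B with
  | zero => simpa using mumap_two_mem m B
  | succ n ih =>
    have h2 : IsUnit (2 : ZMod m) := by
      simpa using (ZMod.isUnit_iff_coprime 2 m).2 (Nat.coprime_two_left.2 hm)
    obtain ⟨D, rfl⟩ := h2.dvd (a := B)
    have h : (mumap m 2 0 ∘ mumap m (2 ^ (n + 1)) D : DihedralGroup m → DihedralGroup m) ∈
        (Lsg m : Set (Function.End (DihedralGroup m))) :=
      (Lsg m).mul_mem (mumap_two_mem m 0) (ih D)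
    rw [mumap_comp, ← pow_succ'] at h
    exact h

theorem coe_Lsg {m : ℕ} (hm : Odd m) :
    (Lsg m : Set (Function.End (DihedralGroup m))) =
      (fun x : ZMod m × ZMod m => mumap m x.1 x.2) '' (multipliers m ×ˢ Set.univ) := by
  apply Set.Subset.antisymm
  · intro f hf
    induction hf using Subsemigroup.closure_induction with
    | mem f hf =>
      obtain ⟨g, rfl⟩ := hf
      rcases g with i | i
      · exact ⟨(0, -i), ⟨Or.inl rfl, trivial⟩, (lmap_r m i).symm⟩
      · exact ⟨(2, -i), ⟨Or.inr ⟨0, by simp⟩, trivial⟩, (lmap_sr m i).symm⟩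
    | mul f g _ _ hf hg =>
      obtain ⟨⟨A, B⟩, ⟨hA, -⟩, rfl⟩ := hf
      obtain ⟨⟨C, D⟩, ⟨hC, -⟩, rfl⟩ := hg
      exact ⟨(A * C, A * D), ⟨mul_mem_multipliers hA hC, trivial⟩,
        (mumap_comp m A B C D).symm⟩
  · rintro _ ⟨⟨A, B⟩, ⟨hA | ⟨n, hA⟩, -⟩, rfl⟩
    · obtain rfl : A = 0 := hA
      exact mumap_zero_mem m B
    · obtain rfl : A = 2 ^ (n + 1) := hA
      exact mumap_two_pow_mem hm n B

theorem card_Lsg {m : ℕ} (hm : Odd m) :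
    Nat.card (Lsg m) = (multipliers m).ncard * m := by
  calc Nat.card (Lsg m) = (Lsg m : Set (Function.End (DihedralGroup m))).ncard := rfl
    _ = ((fun x : ZMod m × ZMod m => mumap m x.1 x.2) '' (multipliers m ×ˢ Set.univ)).ncard :=
      congrArg Set.ncard (coe_Lsg hm)
    _ = (multipliers m).ncard * m := by
      rw [Set.ncard_image_of_injective _ (mumap_injective hm), Set.ncard_prod,
        Set.ncard_univ, Nat.card_zmod]

theorem ncard_multipliers_pos {m : ℕ} [NeZero m] : 0 < (multipliers m).ncard :=
  (Set.ncard_pos (Set.toFinite _)).2 ⟨0, Or.inl rfl⟩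

theorem ncard_multipliers_le {m : ℕ} [NeZero m] : (multipliers m).ncard ≤ m := by
  simpa [Set.ncard_univ] using Set.ncard_le_ncard (Set.subset_univ (multipliers m))

theorem le_of_card_Lsg_eq {p q : ℕ} (hp : p.Prime) (hq : q.Prime) (hp2 : Odd p) (hq2 : Odd q)
    (h : Nat.card (Lsg p) = Nat.card (Lsg q)) : q ≤ p := by
  have : NeZero p := ⟨hp.ne_zero⟩
  rw [card_Lsg hp2, card_Lsg hq2] at h
  rcases hq.dvd_mul.1 (h.symm ▸ Dvd.intro_left _ rfl : q ∣ (multipliers p).ncard * p) with hd | hd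
  · exact (Nat.le_of_dvd ncard_multipliers_pos hd).trans ncard_multipliers_le
  · exact Nat.le_of_dvd hp.pos hd

/-- Theorem 23: for primes `p, q ≥ 3`, if `Λ(D_p) ≅ Λ(D_q)` as semigroups then `p = q`;
in fact already `|Λ(D_p)| = |Λ(D_q)|` forces `p = q`. -/
theorem stmt_19 (p q : ℕ) (hp : p.Prime) (hq : q.Prime) (hp3 : 3 ≤ p) (hq3 : 3 ≤ q) :
    (Nonempty (↥(Lsg p) ≃* ↥(Lsg q)) → p = q) ∧
    (Nat.card ↥(Lsg p) = Nat.card ↥(Lsg q) → p = q) := by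
  have hp2 : Odd p := hp.odd_of_ne_two (by omega)
  have hq2 : Odd q := hq.odd_of_ne_two (by omega)
  have key (h : Nat.card (Lsg p) = Nat.card (Lsg q)) : p = q :=
    le_antisymm (le_of_card_Lsg_eq hq hp hq2 hp2 h.symm) (le_of_card_Lsg_eq hp hq hp2 hq2 h)
  exact ⟨fun ⟨e⟩ => key (Nat.card_congr e.toEquiv), key⟩
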